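/- Let P be a finite nonempty poset and let w*(P) be its cube-width. Then for every integer n with n ≥ 2·w*(P), the induced saturation number satisfies sat*(n, P) ≤ 2·n^(w*(P)−1). -/

import Mathlib

/-- A family `F` of subsets of `[n]` contains an induced copy of the poset `P`
if there is an injective map `f` from `P` into `F` such that
`p ≤ q` in `P` iff `f p ⊆ f q`. -/
def HasCopy (P : Type*) [PartialOrder P] {n : ℕ} (F : Finset (Finset (Fin n))) : Prop :=
  ∃ f : P → Finset (Fin n), Function.Injective f ∧ (∀ p, f p ∈ F) ∧
    ∀ p q, p ≤ q ↔ f p ⊆ f q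

/-- `F` is `P`-saturated: it contains no induced copy of `P`, but adding any
other subset of `[n]` creates an induced copy of `P`. -/
def IsSat (P : Type*) [PartialOrder P] {n : ℕ} (F : Finset (Finset (Fin n))) : Prop :=
  ¬ HasCopy P F ∧ ∀ S : Finset (Fin n), S ∉ F → HasCopy P (insert S F)

/-- The induced saturation number `sat*(n, P)`: the minimum size of a
`P`-saturated family of subsets of `[n]`. -/
noncomputable def satNum (n : ℕ) (P : Type*) [PartialOrder P] : ℕ :=
  sInf {m | ∃ F : Finset (Finset (Fin n)), IsSat P F ∧ F.card = m}

/-- The first `h + 1` layers of the cube `Q_n` (i.e. the subsets of `[n]` of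
size at most `h`, ordered by inclusion) contain an induced copy of `P`. -/
def EmbedsLow (P : Type*) [PartialOrder P] (n h : ℕ) : Prop :=
  ∃ f : P → Finset (Fin n), Function.Injective f ∧ (∀ p, (f p).card ≤ h) ∧
    ∀ p q, p ≤ q ↔ f p ⊆ f q

/-- The cube-height `h*(P)`: the least `h` such that for some `n` the subsets
of `[n]` of size at most `h` contain an induced copy of `P`. -/
noncomputable def cubeHeight (P : Type*) [PartialOrder P] : ℕ :=
  sInf {h | ∃ n, EmbedsLow P n h}

/-- The cube-width `w*(P)`: the least `w` such that the subsets of `[w]` of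
size at most `h*(P)` contain an induced copy of `P`. -/
noncomputable def cubeWidth (P : Type*) [PartialOrder P] : ℕ :=
  sInf {w | EmbedsLow P w (cubeHeight P)}

open Finset

/-- Every finite poset embeds in some cube. -/
theorem exists_embedsLow (P : Type*) [PartialOrder P] [Fintype P] :
    ∃ h n, EmbedsLow P n h := by
  classical
  let e := Fintype.equivFin P
  have key : ∀ p q : P, p ≤ q ↔
      (univ.filter (· ≤ p)).map e.toEmbedding ⊆ (univ.filter (· ≤ q)).map e.toEmbedding := by
    intro p q
    rw [map_subset_map]
    constructor
    · intro hpq x hx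
      simp only [mem_filter, mem_univ, true_and] at hx ⊢
      exact hx.trans hpq
    · intro hsub
      have hp : p ∈ univ.filter (· ≤ p) := by simp
      simpa using hsub hp
  refine ⟨Fintype.card P, Fintype.card P,
    fun p => (univ.filter (· ≤ p)).map e.toEmbedding, ?_, ?_, key⟩
  · intro p q hpq
    exact le_antisymm ((key p q).2 hpq.subset) ((key q p).2 hpq.symm.subset)
  · intro p
    simpa using card_le_univ ((univ.filter (· ≤ p)).map e.toEmbedding)

theorem embedsLow_cubeWidth_cubeHeight (P : Type*) [PartialOrder P] [Fintype P] :
    EmbedsLow P (cubeWidth P) (cubeHeight P) := by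
  have hne : ∃ n, EmbedsLow P n (cubeHeight P) :=
    Nat.sInf_mem (s := {h | ∃ n, EmbedsLow P n h}) (exists_embedsLow P)
  exact Nat.sInf_mem (s := {w | EmbedsLow P w (cubeHeight P)}) hne

/-- The layers strictly below the cube-height contain no copy of `P`. -/
theorem not_hasCopy_layers_below_cubeHeight (P : Type*) [PartialOrder P] [Nonempty P] (n : ℕ) :
    ¬ HasCopy P (univ.filter fun A : Finset (Fin n) => A.card < cubeHeight P) := by
  rintro ⟨f, hinj, hmem, hle⟩
  simp only [mem_filter, mem_univ, true_and] at hmem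
  obtain ⟨p⟩ := ‹Nonempty P›
  have hpos := hmem p
  have hlow : cubeHeight P ≤ cubeHeight P - 1 :=
    Nat.sInf_le ⟨n, f, hinj, fun q => Nat.le_sub_one_of_lt (hmem q), hle⟩
  omega

/-- A family without a copy of `P` is contained in a `P`-saturated family. -/
theorem exists_isSat_superset {P : Type*} [PartialOrder P] {n : ℕ}
    {F₀ : Finset (Finset (Fin n))} (h₀ : ¬ HasCopy P F₀) :
    ∃ F, F₀ ⊆ F ∧ IsSat P F := by
  obtain ⟨F, hF₀, hF⟩ := Finite.exists_le_maximal (p := fun F => ¬ HasCopy P F) h₀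
  refine ⟨F, hF₀, hF.prop, fun S hS => ?_⟩
  by_contra hcopy
  exact hS (hF.le_of_ge hcopy (subset_insert S F) (mem_insert_self S F))

/-- If a family contains all sets of size less than `h` and shatters a set of size at least `w`,
then every poset that embeds in the layers `0, …, h` of the cube on `w` points embeds in it. -/
theorem hasCopy_of_shatters {P : Type*} [PartialOrder P] {n w h : ℕ} (hP : EmbedsLow P w h)
    {F : Finset (Finset (Fin n))} (hF : ∀ A : Finset (Fin n), A.card < h → A ∈ F)
    {T : Finset (Fin n)} (hT : F.Shatters T) (hw : w ≤ T.card) : HasCopy P F := by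
  classical
  obtain ⟨f, -, hcard, hle⟩ := hP
  let e : Fin w ↪ Fin n := (Fin.castLEEmb hw).trans (T.orderEmbOfFin rfl).toEmbedding
  have he : ∀ A : Finset (Fin w), A.map e ⊆ T := by
    intro A x hx
    obtain ⟨i, -, rfl⟩ := mem_map.1 hx
    exact T.orderEmbOfFin_mem rfl _
  have hg : ∀ A : Finset (Fin w), ∃ u ∈ F, T ∩ u = A.map e ∧ (A.card < h → u = A.map e) := by
    intro A
    by_cases hA : A.card < h
    · exact ⟨A.map e, hF _ (by simpa using hA), inter_eq_right.2 (he A), fun _ => rfl⟩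
    · obtain ⟨u, hu, hTu⟩ := hT (he A)
      exact ⟨u, hu, hTu, fun hA' => absurd hA' hA⟩
  choose g hgF hgT hglow using hg
  have key : ∀ p q, p ≤ q ↔ g (f p) ⊆ g (f q) := by
    intro p q
    rw [hle]
    constructor
    · intro hsub
      by_cases hp : (f p).card < h
      · rw [hglow _ hp]
        exact (map_subset_map.2 hsub).trans (hgT (f q) ▸ inter_subset_right)
      · rw [eq_of_subset_of_card_le hsub ((hcard q).trans (not_lt.1 hp))]
    · intro hsub
      rw [← map_subset_map (f := e), ← hgT, ← hgT]
      exact inter_subset_inter_left hsub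
  exact ⟨fun p => g (f p), fun p q hpq => le_antisymm ((key p q).2 hpq.subset)
    ((key q p).2 hpq.symm.subset), fun p => hgF _, key⟩

/-- A form of the Sauer–Shelah lemma. -/
theorem card_le_sum_choose_of_shatters {n w : ℕ} {F : Finset (Finset (Fin n))}
    (hF : ∀ T, F.Shatters T → T.card < w) : F.card ≤ ∑ i ∈ range w, n.choose i := by
  classical
  calc F.card ≤ F.shatterer.card := F.card_le_card_shatterer
    _ ≤ ((range w).biUnion fun i => powersetCard i (univ : Finset (Fin n))).card := by
        refine card_le_card fun T hT => ?_
        simpa using hF T (mem_shatterer.1 hT)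
    _ ≤ ∑ i ∈ range w, (powersetCard i (univ : Finset (Fin n))).card := card_biUnion_le
    _ = ∑ i ∈ range w, n.choose i := by simp

theorem sum_choose_range_le_two_mul_pow {n w : ℕ} (hn : 2 * w ≤ n) :
    ∑ i ∈ range w, n.choose i ≤ 2 * n ^ (w - 1) := by
  rcases w with _ | d
  · simp
  have hn2 : 2 ≤ n := by omega
  clear hn
  induction d with
  | zero => simp
  | succ d ih =>
    rw [sum_range_succ]
    simp only [Nat.add_sub_cancel] at ih ⊢
    have hchoose := Nat.choose_le_pow n (d + 1)
    have hstep : 2 * n ^ d ≤ n ^ (d + 1) := by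
      rw [pow_succ']
      exact Nat.mul_le_mul_right _ hn2
    omega

/-- For every finite nonempty poset `P` and every `n ≥ 2·w*(P)`,
`sat*(n, P) ≤ 2 · n ^ (w*(P) − 1)`. -/
theorem sat_le_two_mul_pow_cubeWidth (P : Type*) [PartialOrder P] [Fintype P] [Nonempty P]
    (n : ℕ) (hn : 2 * cubeWidth P ≤ n) :
    satNum n P ≤ 2 * n ^ (cubeWidth P - 1) := by
  obtain ⟨F, hsub, hF⟩ := exists_isSat_superset (not_hasCopy_layers_below_cubeHeight P n)
  have hsat : satNum n P ≤ F.card := Nat.sInf_le ⟨F, hF, rfl⟩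
  refine hsat.trans
    ((card_le_sum_choose_of_shatters fun T hT => ?_).trans (sum_choose_range_le_two_mul_pow hn))
  by_contra! hw
  exact hF.1 (hasCopy_of_shatters (embedsLow_cubeWidth_cubeHeight P)
    (fun A hA => hsub (by simpa using hA)) hT hw)
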